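/- Let N ≥ 1 and ν ≥ 0 be integers, M = N+ν. Let p_1,…,p_M be pairwise distinct complex numbers, δ_1,…,δ_N pairwise distinct complex numbers with p_i ≠ δ_k for all i,k, and d_1,…,d_N nonzero complex numbers. Let A be the M×M matrix with entries A_{i,k} = p_i^{k−1} for 1 ≤ k ≤ ν and A_{i,ν+k} = d_k / (p_i − δ_k) for 1 ≤ k ≤ N. Then A is invertible and for all 1 ≤ k ≤ N and 1 ≤ l ≤ M, (A^{−1})_{ν+k, l} = d_k^{−1} · [∏_{i≠l} (δ_k − p_i)/(p_l − p_i)] · [∏_{m=1}^{N} (p_l − δ_m)] / [∏_{m≠k} (δ_k − δ_m)]. -/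

import Mathlib

open Matrix Finset

noncomputable section

open Polynomial in
/-- The numerator, over the common denominator `∏ k, (X - δ k)`, of the rational function
`∑ c, u c * X ^ c + ∑ k, w k / (X - δ k)`. -/
def partialFractionNumerator {K : Type*} [Field K] {N ν : ℕ} (δ : Fin N → K) (u : Fin ν → K)
    (w : Fin N → K) : K[X] :=
  (∑ c : Fin ν, C (u c) * X ^ (c : ℕ)) * Lagrange.nodal univ δ
    + ∑ k, C (w k) * Lagrange.nodal (univ.erase k) δ

namespace partialFractionNumerator

open Polynomial

variable {K : Type*} [Field K] {N ν : ℕ} (δ : Fin N → K) (u : Fin ν → K) (w : Fin N → K)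

theorem degree_lt : (partialFractionNumerator δ u w).degree < ((N + ν : ℕ) : WithBot ℕ) := by
  rcases N.eq_zero_or_pos with rfl | h
  · simpa [partialFractionNumerator] using degree_sum_fin_lt u
  refine (degree_add_le _ _).trans_lt (max_lt ?_ ?_)
  · rw [degree_mul, Lagrange.degree_nodal, card_univ, Fintype.card_fin, Nat.cast_add,
      add_comm (N : WithBot ℕ)]
    exact WithBot.add_lt_add_right (WithBot.natCast_ne_bot N) (degree_sum_fin_lt u)
  · refine (degree_sum_le _ _).trans_lt ((Finset.sup_lt_iff (WithBot.bot_lt_coe _)).2 fun k _ => ?_)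
    rw [C_mul']
    refine (degree_smul_le _ _).trans_lt ?_
    rw [Lagrange.degree_nodal, card_erase_of_mem (mem_univ k), card_univ, Fintype.card_fin]
    exact_mod_cast (by omega : N - 1 < N + ν)

theorem eval_pole (k : Fin N) :
    (partialFractionNumerator δ u w).eval (δ k) = w k * ∏ m ∈ univ.erase k, (δ k - δ m) := by
  rw [partialFractionNumerator, eval_add, eval_mul, Lagrange.eval_nodal_at_node (mem_univ k),
    mul_zero, zero_add, eval_finsetSum, sum_eq_single k]
  · rw [eval_mul, eval_C, Lagrange.eval_nodal]
  · intro j _ hj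
    rw [eval_mul, Lagrange.eval_nodal_at_node (mem_erase.2 ⟨hj.symm, mem_univ k⟩), mul_zero]
  · simp

theorem eval_of_ne_pole {z : K} (hz : ∀ k, z ≠ δ k) :
    (partialFractionNumerator δ u w).eval z
      = (∑ c, u c * z ^ (c : ℕ) + ∑ k, w k / (z - δ k)) * ∏ m, (z - δ m) := by
  rw [partialFractionNumerator, eval_add, eval_mul, Lagrange.eval_nodal, eval_finsetSum,
    eval_finsetSum, add_mul, sum_mul (f := fun k => w k / (z - δ k))]
  congr 1
  · simp
  · refine sum_congr rfl fun k _ => ?_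
    rw [eval_mul, eval_C, Lagrange.eval_nodal, ← mul_prod_erase univ _ (mem_univ k)]
    have := sub_ne_zero.2 (hz k)
    field_simp

variable {δ u w}

theorem polynomial_part_eq_zero (h : partialFractionNumerator δ u 0 = 0) : u = 0 := by
  have hV : ∑ c : Fin ν, C (u c) * X ^ (c : ℕ) = 0 := by
    simpa [partialFractionNumerator, Lagrange.nodal_ne_zero] using h
  funext c
  have := congrArg (fun q : K[X] => q.coeff (c : ℕ)) hV
  simpa [finsetSum_coeff, coeff_C_mul, coeff_X_pow, Fin.val_inj] using this

/-- Lagrange interpolation of the numerator at the nodes `p`, evaluated at the pole `δ k`. -/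
theorem residue_mul_prod {p : Fin (N + ν) → K} (hp : Function.Injective p)
    (hpδ : ∀ i k, p i ≠ δ k) (k : Fin N) :
    w k * ∏ m ∈ univ.erase k, (δ k - δ m)
      = ∑ l, (∑ c, u c * p l ^ (c : ℕ) + ∑ j, w j / (p l - δ j)) * (∏ m, (p l - δ m))
          * ∏ i ∈ univ.erase l, (δ k - p i) / (p l - p i) := by
  rw [← eval_pole δ u w k]
  have hdeg : (partialFractionNumerator δ u w).degree < #(univ : Finset (Fin (N + ν))) := by
    simpa using degree_lt δ u w
  conv_lhs => rw [Lagrange.eq_interpolate hp.injOn hdeg]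
  rw [Lagrange.interpolate_apply, eval_finsetSum]
  refine sum_congr rfl fun l _ => ?_
  rw [eval_mul, eval_C, eval_of_ne_pole δ u w (hpδ l), Lagrange.basis, eval_prod]
  congr 1
  refine prod_congr rfl fun i _ => ?_
  simp [Lagrange.basisDivisor, div_eq_inv_mul]

theorem eq_zero_of_eval_eq_zero {p : Fin (N + ν) → K} (hp : Function.Injective p)
    (h : ∀ i, (partialFractionNumerator δ u w).eval (p i) = 0) :
    partialFractionNumerator δ u w = 0 :=
  Polynomial.eq_zero_of_degree_lt_of_eval_index_eq_zero (univ : Finset (Fin (N + ν))) hp.injOn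
    (by simpa using degree_lt δ u w) fun i _ => h i

end partialFractionNumerator

/-- The explicit formula for the lower `N×M` block of the inverse of a mixed
Vandermonde–Cauchy matrix. -/
theorem statement12
    (N ν : ℕ) (hN : 1 ≤ N)
    (p : Fin (N + ν) → ℂ) (hp : Function.Injective p)
    (δ : Fin N → ℂ) (hδ : Function.Injective δ)
    (hpδ : ∀ i k, p i ≠ δ k)
    (d : Fin N → ℂ) (hd : ∀ k, d k ≠ 0)
    (A : Matrix (Fin (N + ν)) (Fin (N + ν)) ℂ)
    (hA : ∀ i c, A i c =
      if h : (c : ℕ) < ν then p i ^ (c : ℕ)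
      else d ⟨(c : ℕ) - ν, by have := c.isLt; omega⟩
            / (p i - δ ⟨(c : ℕ) - ν, by have := c.isLt; omega⟩)) :
    IsUnit A.det ∧
    ∀ (k : Fin N) (l : Fin (N + ν)),
      A⁻¹ ⟨ν + (k : ℕ), by have := k.isLt; omega⟩ l
        = (d k)⁻¹ * (∏ i ∈ Finset.univ.erase l, (δ k - p i) / (p l - p i))
            * (∏ m : Fin N, (p l - δ m))
            / ∏ m ∈ Finset.univ.erase k, (δ k - δ m) := by
  have hcast : ν + N = N + ν := add_comm ν N
  have hmul (x : Fin (N + ν) → ℂ) (i : Fin (N + ν)) :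
      (A *ᵥ x) i = ∑ c : Fin ν, x (Fin.cast hcast (Fin.castAdd N c)) * p i ^ (c : ℕ)
        + ∑ k : Fin N, d k * x (Fin.cast hcast (Fin.natAdd ν k)) / (p i - δ k) := by
    rw [mulVec, dotProduct, ← (finCongr hcast).sum_comp, Fin.sum_univ_add]
    congr 1
    · refine sum_congr rfl fun c _ => ?_
      simp [hA, mul_comm]
    · refine sum_congr rfl fun k _ => ?_
      simp [hA, div_mul_eq_mul_div]
  have hres (x : Fin (N + ν) → ℂ) (k : Fin N) :
      d k * x (Fin.cast hcast (Fin.natAdd ν k)) * ∏ m ∈ univ.erase k, (δ k - δ m)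
        = ∑ l, (A *ᵥ x) l * (∏ m, (p l - δ m))
            * ∏ i ∈ univ.erase l, (δ k - p i) / (p l - p i) := by
    simp only [hmul]
    exact partialFractionNumerator.residue_mul_prod
      (w := fun k => d k * x (Fin.cast hcast (Fin.natAdd ν k))) hp hpδ k
  have hprod (k : Fin N) : ∏ m ∈ univ.erase k, (δ k - δ m) ≠ 0 :=
    prod_ne_zero_iff.2 fun m hm => sub_ne_zero.2 (hδ.ne (ne_of_mem_erase hm).symm)
  have hdet : IsUnit A.det := by
    rw [isUnit_iff_ne_zero]
    intro h0
    obtain ⟨x, hx, hAx⟩ := exists_mulVec_eq_zero_iff.2 h0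
    have hlow (k : Fin N) : x (Fin.cast hcast (Fin.natAdd ν k)) = 0 := by
      simpa [hAx, hd k, hprod k] using hres x k
    have hup : (fun c : Fin ν => x (Fin.cast hcast (Fin.castAdd N c))) = 0 := by
      refine partialFractionNumerator.polynomial_part_eq_zero (δ := δ)
        (partialFractionNumerator.eq_zero_of_eval_eq_zero hp fun i => ?_)
      have hi := hmul x i
      simp only [hAx, hlow, Pi.zero_apply, mul_zero, zero_div, sum_const_zero, add_zero] at hi
      rw [partialFractionNumerator.eval_of_ne_pole _ _ _ (hpδ i), ← hi]
      simp
    refine hx (funext fun c => ?_)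
    obtain ⟨c, rfl⟩ := (finCongr hcast).surjective c
    induction c using Fin.addCases with
    | left c => exact congrFun hup c
    | right k => exact hlow k
  refine ⟨hdet, fun k l => ?_⟩
  have h := hres (A⁻¹ *ᵥ Pi.single l 1) k
  rw [mulVec_mulVec, mul_nonsing_inv A hdet, one_mulVec, sum_eq_single l
    (fun j _ hj => by simp [hj]) (by simp), mulVec_single_one, Pi.single_eq_same, one_mul] at h
  change d k * A⁻¹ ⟨ν + (k : ℕ), _⟩ l * _ = _ at h
  rw [eq_div_iff (hprod k), mul_assoc, eq_inv_mul_iff_mul_eq₀ (hd k), ← mul_assoc, h, mul_comm]
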